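/- Let f, r : ℝ → ℝ be of class C², let A > 0, and let y be a classical solution of y_t + (f(y))_x = y_xx + r(y) on [0,1] × (0,T) with homogeneous Dirichlet boundary conditions and sup_{x∈[0,1]} |y(x,0)| ≤ A. Let ψ₊ and ψ₋ be solutions on [0,T) of the initial value problems ψ₊' = |r(ψ₊)|, ψ₊(0) = A and ψ₋' = −|r(ψ₋)|, ψ₋(0) = −A. Then ψ₋(t) ≤ y(x,t) ≤ ψ₊(t) for all x ∈ [0,1] and all 0 ≤ t < T. -/

import Mathlib

open Set MeasureTheory

/-- `y` is a classical solution of `y_t + (f(y))_x = y_xx + r(y)` on `[0,1] × (0,T)`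
with homogeneous Dirichlet boundary conditions. -/
def IsClassicalSolutionOn (f r : ℝ → ℝ) (T : ℝ) (y : ℝ → ℝ → ℝ) : Prop :=
  ContinuousOn (fun pt : ℝ × ℝ => y pt.1 pt.2) (Icc 0 1 ×ˢ Ico 0 T) ∧
  (∀ t ∈ Ioo (0:ℝ) T, ContDiffOn ℝ 2 (fun x => y x t) (Icc 0 1)) ∧
  (∀ t ∈ Ico (0:ℝ) T, y 0 t = 0 ∧ y 1 t = 0) ∧
  (∀ x ∈ Ioo (0:ℝ) 1, ∀ t ∈ Ioo (0:ℝ) T,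
    HasDerivAt (fun s => y x s)
      (deriv (deriv (fun x' => y x' t)) x - deriv (fun x' => f (y x' t)) x + r (y x t)) t)

open Filter Topology

/-- The second derivative is nonpositive at a local maximum. -/
theorem IsLocalMax.deriv_deriv_nonpos {g : ℝ → ℝ} {x : ℝ} (h : IsLocalMax g x)
    (hc : ContinuousAt g x) : deriv (deriv g) x ≤ 0 := by
  by_contra! hpos
  have hmin := isLocalMin_of_deriv_deriv_pos hpos h.deriv_eq_zero hc
  have hconst : g =ᶠ[𝓝 x] fun _ => g x := by
    filter_upwards [h, hmin] with z h₁ h₂ using le_antisymm h₁ h₂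
  have hzero := hconst.deriv.deriv_eq
  simp only [deriv_const', deriv_const] at hzero
  exact hpos.ne' hzero

/-- The derivative is nonnegative at a point that is maximal among nearby points to its left. -/
theorem HasDerivAt.nonneg_of_eventually_le_left {g : ℝ → ℝ} {d t : ℝ} (hd : HasDerivAt g d t)
    (h : ∀ᶠ s in 𝓝[<] t, g s ≤ g t) : 0 ≤ d := by
  have hslope := (hasDerivWithinAt_iff_tendsto_slope' (by simp)).1
    (hd.hasDerivWithinAt (s := Iio t))
  refine ge_of_tendsto hslope ?_
  filter_upwards [h, self_mem_nhdsWithin] with s hs hst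
  rw [slope_def_field]
  exact div_nonneg_of_nonpos (by linarith) (by linarith [mem_Iio.1 hst])

/-- A classical solution stays below the solution of `ψ' = |r(ψ)|` that dominates it at time
zero. -/
theorem IsClassicalSolutionOn.le_of_hasDerivWithinAt {f r : ℝ → ℝ} {A T : ℝ} {y : ℝ → ℝ → ℝ}
    {ψ : ℝ → ℝ} (hy : IsClassicalSolutionOn f r T y) (hf : Differentiable ℝ f)
    (hr : ContDiff ℝ 1 r) (hA : 0 ≤ A) (hy0 : ∀ x ∈ Icc (0 : ℝ) 1, y x 0 ≤ A) (hψ0 : ψ 0 = A)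
    (hψ : ∀ t ∈ Ico (0 : ℝ) T, HasDerivWithinAt ψ (|r (ψ t)|) (Ico 0 T) t) :
    ∀ x ∈ Icc (0 : ℝ) 1, ∀ t ∈ Ico (0 : ℝ) T, y x t ≤ ψ t := by
  obtain ⟨hcont, hsmooth, hbdry, heq⟩ := hy
  have hψc : ContinuousOn ψ (Ico 0 T) := fun t ht => (hψ t ht).continuousWithinAt
  have hψat : ∀ t ∈ Ioo (0 : ℝ) T, HasDerivAt ψ (|r (ψ t)|) t := fun t ht =>
    (hψ t ⟨ht.1.le, ht.2⟩).hasDerivAt (Ico_mem_nhds ht.1 ht.2)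
  have hψA : ∀ t ∈ Ico (0 : ℝ) T, A ≤ ψ t := by
    have hmono : MonotoneOn ψ (Ico 0 T) := by
      refine monotoneOn_of_deriv_nonneg (convex_Ico 0 T) hψc ?_ ?_ <;> rw [interior_Ico]
      · exact fun t ht => (hψat t ht).differentiableAt.differentiableWithinAt
      · exact fun t ht => (hψat t ht).deriv ▸ abs_nonneg _
    intro t ht
    exact hψ0 ▸ hmono ⟨le_rfl, ht.1.trans_lt ht.2⟩ ht ht.1
  intro x hx t ht
  by_contra! hlt
  have hIcc : Icc 0 t ⊆ Ico 0 T := fun s hs => ⟨hs.1, hs.2.trans_lt ht.2⟩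
  have hK : IsCompact (Icc (0 : ℝ) 1 ×ˢ Icc (0 : ℝ) t) := isCompact_Icc.prod isCompact_Icc
  have hyK : ContinuousOn (fun q : ℝ × ℝ => y q.1 q.2) (Icc 0 1 ×ˢ Icc 0 t) :=
    hcont.mono (prod_mono_right hIcc)
  have hψK : ContinuousOn (fun q : ℝ × ℝ => ψ q.2) (Icc 0 1 ×ˢ Icc 0 t) :=
    hψc.comp continuousOn_snd fun q hq => hIcc hq.2
  obtain ⟨M₁, hM₁⟩ := hK.exists_bound_of_continuousOn hyK
  obtain ⟨M₂, hM₂⟩ := hK.exists_bound_of_continuousOn hψK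
  obtain ⟨L, hL⟩ := hr.contDiffOn.exists_lipschitzOnWith one_ne_zero
    (convex_Icc (-max M₁ M₂) (max M₁ M₂)) isCompact_Icc
  let v : ℝ × ℝ → ℝ := fun q => Real.exp (-((L + 1 : ℝ) * q.2)) * (y q.1 q.2 - ψ q.2)
  have hv : ContinuousOn v (Icc 0 1 ×ˢ Icc 0 t) :=
    ContinuousOn.mul (by fun_prop) (hyK.sub hψK)
  obtain ⟨⟨a, s⟩, ⟨ha, hs⟩, hmax⟩ := hK.exists_isMaxOn ⟨(x, t), hx, ht.1, le_rfl⟩ hv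
  simp only at ha hs
  have hgap : ψ s < y a s := by
    have h₁ : 0 < v (x, t) := mul_pos (Real.exp_pos _) (sub_pos.2 hlt)
    have h₂ : 0 < v (a, s) := h₁.trans_le (hmax ⟨hx, ht.1, le_rfl⟩)
    exact sub_pos.1 (pos_of_mul_pos_right h₂ (Real.exp_pos _).le)
  have hψs := hψA s (hIcc hs)
  have hs0 : 0 < s := by
    refine hs.1.lt_of_ne ?_
    rintro rfl
    linarith [hy0 a ha]
  have hsT : s ∈ Ioo 0 T := ⟨hs0, (hIcc hs).2⟩
  have ha01 : a ∈ Ioo (0 : ℝ) 1 := by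
    obtain ⟨h₀, h₁⟩ := hbdry s (hIcc hs)
    refine ⟨ha.1.lt_of_ne ?_, ha.2.lt_of_ne ?_⟩ <;> rintro rfl <;> linarith
  have hdiff : DifferentiableAt ℝ (fun z => y z s) a :=
    ((hsmooth s hsT).contDiffAt (Icc_mem_nhds ha01.1 ha01.2)).differentiableAt two_ne_zero
  have hlocmax : IsLocalMax (fun z => y z s) a := by
    filter_upwards [Icc_mem_nhds ha01.1 ha01.2] with z hz
    have h : v (z, s) ≤ v (a, s) := hmax ⟨hz, hs⟩
    have := le_of_mul_le_mul_left h (Real.exp_pos _)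
    simpa using this
  have hflux : deriv (fun z => f (y z s)) a = 0 := by
    have h := (hf (y a s)).hasDerivAt.comp a hdiff.hasDerivAt
    rw [hlocmax.deriv_eq_zero, mul_zero] at h
    exact h.deriv
  have hyxx := hlocmax.deriv_deriv_nonpos hdiff.continuousAt
  have hyt := heq a ha01 s hsT
  rw [hflux] at hyt
  have hexp : HasDerivAt (fun τ : ℝ => Real.exp (-((L + 1 : ℝ) * τ)))
      (Real.exp (-((L + 1 : ℝ) * s)) * -((L + 1 : ℝ) * 1)) s :=
    ((hasDerivAt_id s).const_mul (L + 1 : ℝ)).neg.exp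
  have hvt := (hexp.mul (hyt.sub (hψat s hsT))).nonneg_of_eventually_le_left (by
    filter_upwards [Ioo_mem_nhdsLT hs0] with τ hτ
    have hτK : (a, τ) ∈ Icc (0 : ℝ) 1 ×ˢ Icc 0 t := ⟨ha, hτ.1.le, hτ.2.le.trans hs.2⟩
    exact hmax hτK)
  have hlip := hL.dist_le_mul (y a s)
    (abs_le.1 ((hM₁ (a, s) ⟨ha, hs⟩).trans (le_max_left _ _))) (ψ s)
    (abs_le.1 ((hM₂ (a, s) ⟨ha, hs⟩).trans (le_max_right _ _)))
  rw [Real.dist_eq, Real.dist_eq, abs_of_pos (sub_pos.2 hgap)] at hlip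
  have hrate := le_of_abs_le hlip
  have habs := le_abs_self (r (ψ s))
  simp only [Pi.sub_apply] at hvt
  have hneg : deriv (deriv fun z => y z s) a - 0 + r (y a s) - |r (ψ s)|
      - (L + 1) * (y a s - ψ s) < 0 := by
    linarith
  have := mul_neg_of_pos_of_neg (Real.exp_pos (-((L + 1 : ℝ) * s))) hneg
  linarith

/-- Reflecting a classical solution gives a classical solution of the reflected equation. -/
theorem IsClassicalSolutionOn.neg {f r : ℝ → ℝ} {T : ℝ} {y : ℝ → ℝ → ℝ}
    (hy : IsClassicalSolutionOn f r T y) :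
    IsClassicalSolutionOn (fun u => -f (-u)) (fun u => -r (-u)) T (fun x t => -y x t) := by
  obtain ⟨hcont, hsmooth, hbdry, heq⟩ := hy
  refine ⟨hcont.neg, fun t ht => (hsmooth t ht).neg, fun t ht => ?_, fun x hx t ht => ?_⟩
  · simpa using hbdry t ht
  · refine (heq x hx t ht).neg.congr_deriv ?_
    simp only [neg_neg, deriv.fun_neg']
    ring

/-- comparison with the solutions of `ψ₊' = |r(ψ₊)|, ψ₊(0) = A` and
`ψ₋' = −|r(ψ₋)|, ψ₋(0) = −A` (parabolic maximum principle). -/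
theorem comparison_principle
    (f r : ℝ → ℝ) (hf : ContDiff ℝ 2 f) (hr : ContDiff ℝ 2 r)
    (A T : ℝ) (hA : 0 < A)
    (y : ℝ → ℝ → ℝ) (hy : IsClassicalSolutionOn f r T y)
    (hy0 : ∀ x ∈ Icc (0:ℝ) 1, |y x 0| ≤ A)
    (ψp ψm : ℝ → ℝ)
    (hψp0 : ψp 0 = A)
    (hψm0 : ψm 0 = -A)
    (hψp : ∀ t ∈ Ico (0:ℝ) T, HasDerivWithinAt ψp (|r (ψp t)|) (Ico 0 T) t)
    (hψm : ∀ t ∈ Ico (0:ℝ) T, HasDerivWithinAt ψm (-|r (ψm t)|) (Ico 0 T) t) :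
    ∀ x ∈ Icc (0:ℝ) 1, ∀ t ∈ Ico (0:ℝ) T, ψm t ≤ y x t ∧ y x t ≤ ψp t := by
  intro x hx t ht
  have hlower := hy.neg.le_of_hasDerivWithinAt (A := A) (ψ := fun t => -ψm t)
    ((hf.differentiable two_ne_zero).comp differentiable_neg).neg
    ((hr.of_le one_le_two).comp contDiff_neg).neg hA.le
    (fun x hx => neg_le.1 (abs_le.1 (hy0 x hx)).1) (by simp [hψm0])
    (fun t ht => (hψm t ht).neg.congr_deriv (by simp)) x hx t ht
  exact ⟨neg_le_neg_iff.1 hlower,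
    hy.le_of_hasDerivWithinAt (hf.differentiable two_ne_zero) (hr.of_le one_le_two) hA.le
      (fun x hx => (abs_le.1 (hy0 x hx)).2) hψp0 hψp x hx t ht⟩
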